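/- Let q = q_0^k be a prime power, N the norm from F_q to F_{q_0}, and t_1, ..., t_{k-1}, t_k = 1, A_1, ..., A_k as in the Lagrange setup. Suppose a_1, ..., a_k ∈ F_q satisfy N(a_i) = A_i for all i. Then the affine line ℓ = {(a_1(1 + μ t_1), ..., a_k(1 + μ t_k)) : μ ∈ F_q} intersects the norm hypersurface H_k = {(x_1,...,x_k) ∈ F_q^k : ∑_{i=1}^k N(x_i) = 1} exactly in the single point (a_1, ..., a_k). -/

import Mathlib

open Polynomial in
theorem Lagrange.eval_zero_basis {F ι : Type*} [Field F] [DecidableEq ι] (s : Finset ι) (t : ι → F)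
    (i : ι) : eval 0 (Lagrange.basis s t i) = ∏ j ∈ s.erase i, t j / (t j - t i) := by
  rw [Lagrange.basis, eval_prod]
  refine Finset.prod_congr rfl fun j _ => ?_
  rw [basisDivisor, eval_mul, eval_C, eval_sub, eval_X, eval_C, zero_sub, mul_neg, ← neg_sub,
    inv_neg, neg_mul, neg_neg, div_eq_inv_mul]

open Polynomial in
/-- The constant term of a polynomial of degree equal to the number of Lagrange nodes is recovered
from its values at the nodes, up to a multiple of the product of the negated nodes. -/
theorem Lagrange.sum_prod_div_mul_eval_of_degree_eq {F ι : Type*} [Field F] [DecidableEq ι]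
    {s : Finset ι} {t : ι → F} (ht : Set.InjOn t s) {P : F[X]} (hP : P.degree = s.card) :
    ∑ i ∈ s, (∏ j ∈ s.erase i, t j / (t j - t i)) * P.eval (t i) =
      P.eval 0 - P.leadingCoeff * ∏ i ∈ s, -t i := by
  have hP0 : P ≠ 0 := by
    rintro rfl
    simp at hP
  have hc : P.leadingCoeff ≠ 0 := leadingCoeff_ne_zero.2 hP0
  have hdeg : (P - C P.leadingCoeff * nodal s t).degree < s.card := by
    rw [← hP]
    refine degree_sub_lt_left ?_ hP0 ?_
    · rw [degree_C_mul hc, degree_nodal, hP]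
    · simp [(nodal_monic (s := s) (v := t)).leadingCoeff]
  have h := congrArg (eval 0) (eq_interpolate ht hdeg)
  rw [interpolate_apply, eval_finsetSum, eval_sub, eval_mul, eval_C, eval_nodal] at h
  simp only [zero_sub] at h
  rw [h]
  refine Finset.sum_congr rfl fun i hi => ?_
  rw [eval_mul, eval_C, eval_zero_basis, eval_sub, eval_mul, eval_nodal_at_node hi, mul_zero, sub_zero,
    mul_comm]

/-- The norm of `1 + μ t`, for `t` fixed
by Frobenius, is a product of linear polynomials in `t`. -/
theorem prod_one_add_mul_pow_pow {F : Type*} [Field F] {p n : ℕ} [Fact p.Prime] [CharP F p]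
    (k : ℕ) (μ t : F) (ht : t ^ p ^ n = t) :
    ∏ j ∈ Finset.range k, (1 + μ * t) ^ (p ^ n) ^ j =
      ∏ j ∈ Finset.range k, (μ ^ (p ^ n) ^ j * t + 1) := by
  refine Finset.prod_congr rfl fun j _ => ?_
  have htj : t ^ (p ^ n) ^ j = t := by
    clear * - ht
    induction j with
    | zero => simp
    | succ j ih => rw [pow_succ, pow_mul, ih, ht]
  rw [← htj, ← pow_mul p n j, add_pow_char_pow, mul_pow, one_pow, pow_mul p n j, htj, htj, add_comm]

open Polynomial in
/-- The weighted sum of the norms of `1 + μ tᵢ` with the Lagrange weights at zero. -/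
theorem sum_lagrange_weight_mul_norm {F ι : Type*} [Field F] [DecidableEq ι] {p n : ℕ}
    [Fact p.Prime] [CharP F p] {s : Finset ι} {t : ι → F} (hinj : Set.InjOn t s)
    (ht : ∀ i ∈ s, t i ^ p ^ n = t i) {μ : F} (hμ : μ ≠ 0) :
    ∑ i ∈ s, (∏ j ∈ s.erase i, t j / (t j - t i)) *
        ∏ j ∈ Finset.range s.card, (1 + μ * t i) ^ (p ^ n) ^ j =
      1 - (∏ j ∈ Finset.range s.card, μ ^ (p ^ n) ^ j) * ∏ i ∈ s, -t i := by
  set P : F[X] := ∏ j ∈ Finset.range s.card, (C (μ ^ (p ^ n) ^ j) * X + C 1) with hPdef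
  have hm (j : ℕ) : μ ^ (p ^ n) ^ j ≠ 0 := pow_ne_zero _ hμ
  have hdeg : P.degree = s.card := by
    rw [hPdef, degree_prod, Finset.sum_congr rfl fun j _ => degree_linear (hm j)]
    simp
  have hlead : P.leadingCoeff = ∏ j ∈ Finset.range s.card, μ ^ (p ^ n) ^ j := by
    rw [hPdef, leadingCoeff_prod]
    exact Finset.prod_congr rfl fun j _ => leadingCoeff_linear (hm j)
  have h := Lagrange.sum_prod_div_mul_eval_of_degree_eq hinj hdeg
  have h0 : P.eval 0 = 1 := by simp [hPdef, eval_prod]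
  rw [h0, hlead] at h
  rw [← h]
  refine Finset.sum_congr rfl fun i hi => ?_
  rw [prod_one_add_mul_pow_pow _ _ _ (ht i hi), hPdef, eval_prod]
  simp

/-- The Lagrange weights at zero sum to one. -/
theorem sum_lagrange_weight {F ι : Type*} [Field F] [DecidableEq ι] {s : Finset ι} {t : ι → F}
    (hinj : Set.InjOn t s) (hs : s.Nonempty) :
    ∑ i ∈ s, ∏ j ∈ s.erase i, t j / (t j - t i) = 1 := by
  have h := congrArg (Polynomial.eval 0) (Lagrange.sum_basis hinj hs)
  rw [Polynomial.eval_finsetSum, Polynomial.eval_one] at h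
  rw [← h]
  exact Finset.sum_congr rfl fun i _ => (Lagrange.eval_zero_basis s t i).symm


/-- Tangent line to the norm hypersurface: with the Lagrange setup
(`t₁,…,t_{k-1}` pairwise distinct in the subfield of order `q₀`, avoiding `{0,1}`,
`t_k = 1`, `A_i = ∏_{j≠i} t_j/(t_j - t_i)`), if `a₁,…,a_k ∈ F` satisfy
`N(a_i) = A_i` (with `N(x) = ∏_{j<k} x^{q₀^j}` the norm), then the affine line
`{(a_1(1+μt_1),…,a_k(1+μt_k)) : μ ∈ F}` meets the norm hypersurface
`H_k = {x : ∑_i N(x_i) = 1}` exactly in the point `(a_1,…,a_k)`. -/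
theorem stmt_6 (F : Type*) [Field F] [Fintype F] (q0 k : ℕ) (hq0 : IsPrimePow q0)
    (hk : 2 ≤ k) (hcard : Fintype.card F = q0 ^ k)
    (t : Fin k → F)
    (hsub : ∀ i, t i ^ q0 = t i)
    (hlast : t ⟨k - 1, by omega⟩ = 1)
    (hdist : ∀ i j : Fin k, (i : ℕ) < k - 1 → (j : ℕ) < k - 1 → i ≠ j → t i ≠ t j)
    (hne : ∀ i : Fin k, (i : ℕ) < k - 1 → t i ≠ 0 ∧ t i ≠ 1)
    (A : Fin k → F)
    (hA : ∀ i, A i = ∏ j ∈ Finset.univ.erase i, t j / (t j - t i))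
    (a : Fin k → F)
    (ha : ∀ i, ∏ j ∈ Finset.range k, (a i) ^ (q0 ^ j) = A i) :
    {x : Fin k → F |
        (∃ μ : F, x = fun i => a i * (1 + μ * t i)) ∧
        ∑ i, ∏ j ∈ Finset.range k, (x i) ^ (q0 ^ j) = 1}
      = {a} := by
  obtain ⟨p, n, hp, -, rfl⟩ := hq0
  have : Fact p.Prime := ⟨hp.nat_prime⟩
  have : CharP F p := charP_of_card_eq_prime_pow (f := n * k)
    (by rw [hcard, pow_mul])
  have hlast' (i : Fin k) (hi : ¬ (i : ℕ) < k - 1) : i = ⟨k - 1, by omega⟩ :=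
    Fin.ext (by have := i.isLt; simp only; omega)
  have ht0 (i : Fin k) : t i ≠ 0 := by
    by_cases hi : (i : ℕ) < k - 1
    · exact (hne i hi).1
    · rw [hlast' i hi, hlast]
      exact one_ne_zero
  have hinj : Function.Injective t := by
    intro i j hij
    by_cases hi : (i : ℕ) < k - 1 <;> by_cases hj : (j : ℕ) < k - 1
    · by_contra h
      exact hdist i j hi hj h hij
    · rw [hlast' j hj, hlast] at hij
      exact absurd hij (hne i hi).2
    · rw [hlast' i hi, hlast] at hij
      exact absurd hij.symm (hne j hj).2
    · rw [hlast' i hi, hlast' j hj]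
  have hne_univ : (Finset.univ : Finset (Fin k)).Nonempty := ⟨⟨0, by omega⟩, Finset.mem_univ _⟩
  ext x
  simp only [Set.mem_ofPred_eq, Set.mem_singleton_iff]
  constructor
  · rintro ⟨⟨μ, rfl⟩, hx⟩
    by_cases hμ : μ = 0
    · simp [hμ]
    have h := sum_lagrange_weight_mul_norm (p := p) (n := n) (s := Finset.univ) hinj.injOn
      (fun i _ => hsub i) hμ
    simp only [mul_pow, Finset.prod_mul_distrib, ha, hA] at hx
    rw [Finset.card_univ, Fintype.card_fin, hx, eq_comm, sub_eq_self] at h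
    refine absurd h (mul_ne_zero ?_ ?_)
    · exact Finset.prod_ne_zero_iff.2 fun j _ => pow_ne_zero _ hμ
    · exact Finset.prod_ne_zero_iff.2 fun i _ => neg_ne_zero.2 (ht0 i)
  · rintro rfl
    refine ⟨⟨0, by simp⟩, ?_⟩
    simp only [ha, hA]
    exact sum_lagrange_weight hinj.injOn hne_univ
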